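/- Let A be a 4-dimensional system indexed by Fin 2 × Fin 2 and B a qubit. Consider the state ρ = (I₂/2) ⊗ |Φ⁺⟩⟨Φ⁺| on A⊗B, i.e., the matrix with entries ρ ((a₁,a₂),b) ((a₁',a₂'),b') = (1/4)·(if a₁ = a₁' then 1 else 0)·(if a₂ = b then 1 else 0)·(if a₂' = b' then 1 else 0), where |Φ⁺⟩ = (|00⟩+|11⟩)/√2. Then ρ satisfies the spectrum condition (the multiset of nonzero eigenvalues of ρ equals that of ρ_B, namely {1/2, 1/2}), but ρ does not admit any symmetric extension. -/

import Mathlib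

open Matrix Kronecker ComplexOrder

noncomputable section

/-- `σ` is a symmetric extension of the bipartite state `ρ`:
`σ` is PSD, has trace 1, its partial trace over the third factor is `ρ`,
and it is invariant under swapping the two `B` factors. -/
def IsSymExt {A B : Type*} [Fintype A] [DecidableEq A] [Fintype B] [DecidableEq B]
    (ρ : Matrix (A × B) (A × B) ℂ)
    (σ : Matrix (A × B × B) (A × B × B) ℂ) : Prop :=
  σ.PosSemidef ∧ σ.trace = 1 ∧
  (∀ a a' b b', ∑ c, σ (a, b, c) (a', b', c) = ρ (a, b) (a', b')) ∧
  (∀ a b₁ b₂ a' b₁' b₂', σ (a, b₁, b₂) (a', b₁', b₂') = σ (a, b₂, b₁) (a', b₂', b₁'))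

/-- The reduced state on the second factor. -/
def reduceB {A B : Type*} [Fintype A] (ρ : Matrix (A × B) (A × B) ℂ) : Matrix B B ℂ :=
  fun b b' => ∑ a, ρ (a, b) (a, b')

/-- The multiset of nonzero eigenvalues (with algebraic multiplicity). -/
def nonzeroSpec {n : Type*} [Fintype n] [DecidableEq n] (M : Matrix n n ℂ) : Multiset ℂ :=
  M.charpoly.roots.filter (· ≠ 0)

/-- The largest (real) eigenvalue of a matrix. -/
def lamMax {n : Type*} [Fintype n] [DecidableEq n] (M : Matrix n n ℂ) : ℝ :=
  sSup {x : ℝ | (x : ℂ) ∈ spectrum ℂ M}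

/-- `ρ` admits a pure (rank-one) symmetric extension. -/
def PureExt {A B : Type*} [Fintype A] [DecidableEq A] [Fintype B] [DecidableEq B]
    (ρ : Matrix (A × B) (A × B) ℂ) : Prop :=
  ∃ σ : Matrix (A × B × B) (A × B × B) ℂ, IsSymExt ρ σ ∧ σ.rank = 1

theorem Matrix.PosSemidef.apply_eq_zero_of_diag_right {n : Type*} [Fintype n] [DecidableEq n]
    {M : Matrix n n ℂ} (hM : M.PosSemidef) {j : n} (hj : M j j = 0) (i : n) : M i j = 0 := by
  have h := (hM.dotProduct_mulVec_zero_iff (Pi.single j 1)).1 (by simp [hj])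
  simpa using congrFun h i

theorem Matrix.PosSemidef.apply_eq_zero_of_diag_left {n : Type*} [Fintype n] [DecidableEq n]
    {M : Matrix n n ℂ} (hM : M.PosSemidef) {i : n} (hi : M i i = 0) (j : n) : M i j = 0 := by
  rw [← hM.isHermitian.apply, hM.apply_eq_zero_of_diag_right hi, star_zero]

theorem nonzeroSpec_mul_comm {m n : Type*} [Fintype m] [DecidableEq m] [Fintype n]
    [DecidableEq n] (A : Matrix m n ℂ) (B : Matrix n m ℂ) :
    nonzeroSpec (A * B) = nonzeroSpec (B * A) := by
  have h := congrArg (fun p => p.roots.filter (· ≠ 0)) (charpoly_mul_comm' A B)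
  have hpow (k : ℕ) (p : Polynomial ℂ) (hp : p.Monic) :
      (Polynomial.X ^ k * p).roots.filter (· ≠ 0) = p.roots.filter (· ≠ 0) := by
    rw [Polynomial.roots_mul (mul_ne_zero (by simp) hp.ne_zero), Multiset.filter_add,
      Polynomial.roots_X_pow, Multiset.nsmul_singleton, Multiset.filter_eq_nil.2, zero_add]
    intro a ha
    simp [Multiset.eq_of_mem_replicate ha]
  simpa only [nonzeroSpec, hpow _ _ (charpoly_monic _)] using h

theorem nonzeroSpec_diagonal {n : Type*} [Fintype n] [DecidableEq n] (d : n → ℂ) :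
    nonzeroSpec (diagonal d) = (Finset.univ.val.map d).filter (· ≠ 0) := by
  have h := Polynomial.roots_multiset_prod_X_sub_C (Finset.univ.val.map d)
  rw [Multiset.map_map] at h
  rw [nonzeroSpec, charpoly_diagonal]
  exact congrArg (Multiset.filter (· ≠ 0)) h

/-- The diagonal of a symmetric extension vanishes wherever that of `ρ` does,
for either copy of `B`. -/
theorem IsSymExt.diag_eq_zero {A B : Type*} [Fintype A] [DecidableEq A] [Fintype B]
    [DecidableEq B] {ρ : Matrix (A × B) (A × B) ℂ} {σ : Matrix (A × B × B) (A × B × B) ℂ}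
    (h : IsSymExt ρ σ) {a : A} {b : B} (hρ : ρ (a, b) (a, b) = 0) (c : B) :
    σ (a, b, c) (a, b, c) = 0 ∧ σ (a, c, b) (a, c, b) = 0 := by
  obtain ⟨hpos, -, hmarg, hswap⟩ := h
  have hzero : σ (a, b, c) (a, b, c) = 0 :=
    (Finset.sum_eq_zero_iff_of_nonneg fun _ _ => hpos.diag_nonneg).1
      ((hmarg a a b b).trans hρ) c (Finset.mem_univ c)
  exact ⟨hzero, (hswap a c b a c b).trans hzero⟩

/-- The 4×2 counterexample: `(I/2) ⊗ |Φ⁺⟩⟨Φ⁺|` satisfies the spectrum condition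
but has no symmetric extension. -/
theorem stmt_8
    (ρ : Matrix ((Fin 2 × Fin 2) × Fin 2) ((Fin 2 × Fin 2) × Fin 2) ℂ)
    (hρdef : ρ = fun p q => (1 / 4 : ℂ) *
      (if p.1.1 = q.1.1 then 1 else 0) *
      (if p.1.2 = p.2 then 1 else 0) * (if q.1.2 = q.2 then 1 else 0)) :
    nonzeroSpec ρ = nonzeroSpec (reduceB ρ) ∧
    nonzeroSpec ρ = {(1 / 2 : ℂ), (1 / 2 : ℂ)} ∧
    ¬ ∃ σ, IsSymExt ρ σ := by
  have hspec_eq : nonzeroSpec (diagonal fun _ : Fin 2 => (1 / 2 : ℂ)) = {1 / 2, 1 / 2} := by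
    rw [nonzeroSpec_diagonal, Multiset.filter_eq_self.2 (by simp)]
    rfl
  have hreduce : reduceB ρ = diagonal fun _ => 1 / 2 := by
    ext b b'
    fin_cases b <;> fin_cases b' <;>
      simp [hρdef, reduceB, Fintype.sum_prod_type] <;> norm_num
  obtain ⟨U, hU⟩ : ∃ U : Matrix ((Fin 2 × Fin 2) × Fin 2) (Fin 2) ℂ, ∀ p k, U p k =
      (1 / 2) * (if p.1.1 = k then 1 else 0) * (if p.1.2 = p.2 then 1 else 0) :=
    ⟨_, fun _ _ => rfl⟩
  have hfactor : ρ = U * Uᵀ := by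
    ext ⟨⟨a, b⟩, c⟩ ⟨⟨a', b'⟩, c'⟩
    simp only [hρdef, hU, mul_apply, transpose_apply, Fin.sum_univ_two]
    fin_cases a <;> fin_cases a' <;> simp <;>
      split_ifs <;> norm_num
  have hgram : Uᵀ * U = diagonal fun _ => 1 / 2 := by
    ext k l
    fin_cases k <;> fin_cases l <;>
      simp [hU, mul_apply, Fintype.sum_prod_type] <;> norm_num
  have hspec : nonzeroSpec ρ = {1 / 2, 1 / 2} := by
    rw [hfactor, nonzeroSpec_mul_comm, hgram, hspec_eq]
  refine ⟨by rw [hspec, hreduce, hspec_eq], hspec, ?_⟩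
  rintro ⟨σ, hσ⟩
  have hcol := hσ.1.apply_eq_zero_of_diag_right
    (hσ.diag_eq_zero (a := (0, 1)) (b := 0) (by simp [hρdef]) 1).2 ((0, 0), 0, 0)
  have hrow := hσ.1.apply_eq_zero_of_diag_left
    (hσ.diag_eq_zero (a := (0, 0)) (b := 1) (by simp [hρdef]) 0).2 ((0, 1), 1, 1)
  have hmarg := hσ.2.2.1 (0, 0) (0, 1) 0 1
  rw [Fin.sum_univ_two, hcol, hrow] at hmarg
  simp [hρdef] at hmarg
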